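/- One has δ(t) ≤ (h/2) ∧ (R r² λ_t^{1+dρ} / (C₁ (ln(1/r))³ n_t^{6+4dρ})), and ε_φ(δ(t)) ≤ (r ∧ λ_t^{1/2}) / (C₁ n_t³). -/

import Mathlib

open MeasureTheory
noncomputable section

/-- The function `f_h(t) = 2/h + C₁(ln 1/r)³ n_t^{6+4dρ}/(R r² λ_t^{1+dρ})
  + C₁² n_t⁶ |φ_t|²/(r² ∧ λ_t)`. -/
def fh {d : ℕ} (h R r ρ C₁ : ℝ) (nf lf : ℝ → ℝ) (φ : ℝ → EuclideanSpace ℝ (Fin d))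
    (s : ℝ) : ℝ :=
  2 / h + C₁ * Real.log (1 / r) ^ 3 * nf s ^ ((6 : ℝ) + 4 * d * ρ)
      / (R * r ^ 2 * lf s ^ ((1 : ℝ) + d * ρ))
    + C₁ ^ 2 * nf s ^ 6 * ‖φ s‖ ^ 2 / min (r ^ 2) (lf s)

/-- `δ(t) = inf{δ > 0 : ∫_t^{t+δ} f_h(s) ds ≥ 1/μ⁸}`. -/
def delfun {d : ℕ} (h R r ρ C₁ μ : ℝ) (nf lf : ℝ → ℝ)
    (φ : ℝ → EuclideanSpace ℝ (Fin d)) (t : ℝ) : ℝ :=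
  sInf {δ : ℝ | 0 < δ ∧ 1 / μ ^ 8 ≤ ∫ s in t..(t + δ), fh h R r ρ C₁ nf lf φ s}

/-- The coefficient `C₁(ln 1/r)³ n_s^{6+4dρ}/(R r² λ_s^{1+dρ})` in `fh`. -/
def driftWeight (d : ℕ) (R r ρ C₁ : ℝ) (nf lf : ℝ → ℝ) (s : ℝ) : ℝ :=
  C₁ * Real.log (1 / r) ^ 3 * nf s ^ ((6 : ℝ) + 4 * d * ρ)
    / (R * r ^ 2 * lf s ^ ((1 : ℝ) + d * ρ))

/-- The coefficient `C₁² n_s⁶/(r² ∧ λ_s)` of `|φ_s|²` in `fh`. -/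
def controlWeight (r C₁ : ℝ) (nf lf : ℝ → ℝ) (s : ℝ) : ℝ :=
  C₁ ^ 2 * nf s ^ 6 / min (r ^ 2) (lf s)

lemma fh_eq {d : ℕ} (h R r ρ C₁ : ℝ) (nf lf : ℝ → ℝ) (φ : ℝ → EuclideanSpace ℝ (Fin d))
    (s : ℝ) : fh h R r ρ C₁ nf lf φ s =
      2 / h + driftWeight d R r ρ C₁ nf lf s + controlWeight r C₁ nf lf s * ‖φ s‖ ^ 2 := by
  unfold fh driftWeight controlWeight
  ring

lemma driftWeight_pos {d : ℕ} {R r ρ C₁ : ℝ} {nf lf : ℝ → ℝ} {s : ℝ}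
    (hn : 1 ≤ nf s) (hl : 0 < lf s) (hR : 0 < R) (hr : 0 < r) (hr1 : r < 1) (hC : 1 ≤ C₁) :
    0 < driftWeight d R r ρ C₁ nf lf s := by
  have hlog : 0 < Real.log (1 / r) := Real.log_pos (by rwa [lt_div_iff₀ hr, one_mul])
  have hn0 : 0 < nf s := by linarith
  have hC0 : 0 < C₁ := by linarith
  unfold driftWeight
  positivity

lemma controlWeight_pos {r C₁ : ℝ} {nf lf : ℝ → ℝ} {s : ℝ}
    (hn : 1 ≤ nf s) (hl : 0 < lf s) (hr : 0 < r) (hC : 1 ≤ C₁) :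
    0 < controlWeight r C₁ nf lf s := by
  have hn0 : 0 < nf s := by linarith
  have hC0 : 0 < C₁ := by linarith
  have hm : 0 < min (r ^ 2) (lf s) := lt_min (by positivity) hl
  unfold controlWeight
  positivity

lemma driftWeight_le {d : ℕ} {μ R r ρ C₁ : ℝ} {nf lf : ℝ → ℝ} {s t : ℝ} (hμ : 1 ≤ μ)
    (hns : 1 ≤ nf s) (hnt : 1 ≤ nf t) (hls : 0 < lf s) (hlt : 0 < lf t)
    (hn : nf t ≤ μ * nf s) (hl : lf s ≤ μ * lf t) (hR : 0 < R) (hr : 0 < r) (hr1 : r < 1)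
    (hρ : 0 < ρ) (hdρ : (d : ℝ) * ρ ≤ 1 / 5) (hC : 1 ≤ C₁) :
    driftWeight d R r ρ C₁ nf lf t ≤ μ ^ 8 * driftWeight d R r ρ C₁ nf lf s := by
  have hlog : 0 < Real.log (1 / r) := Real.log_pos (by rwa [lt_div_iff₀ hr, one_mul])
  have hμ0 : 0 < μ := by linarith
  have hns0 : 0 < nf s := by linarith
  have hnt0 : 0 < nf t := by linarith
  have hC0 : 0 < C₁ := by linarith
  have hnum : nf t ^ ((6 : ℝ) + 4 * d * ρ) ≤
      μ ^ ((6 : ℝ) + 4 * d * ρ) * nf s ^ ((6 : ℝ) + 4 * d * ρ) := by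
    rw [← Real.mul_rpow hμ0.le hns0.le]
    exact Real.rpow_le_rpow hnt0.le hn (by positivity)
  have hden : lf s ^ ((1 : ℝ) + d * ρ) ≤
      μ ^ ((1 : ℝ) + d * ρ) * lf t ^ ((1 : ℝ) + d * ρ) := by
    rw [← Real.mul_rpow hμ0.le hlt.le]
    exact Real.rpow_le_rpow hls.le hl (by positivity)
  have hexp : μ ^ ((6 : ℝ) + 4 * d * ρ) * μ ^ ((1 : ℝ) + d * ρ) ≤ μ ^ 8 := by
    rw [← Real.rpow_add hμ0, ← Real.rpow_natCast]
    refine Real.rpow_le_rpow_of_exponent_le hμ ?_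
    push_cast
    linarith
  unfold driftWeight
  generalize (6 : ℝ) + 4 * d * ρ = p at *
  generalize (1 : ℝ) + d * ρ = q at *
  have hprod : nf t ^ p * lf s ^ q ≤ μ ^ 8 * (nf s ^ p * lf t ^ q) := by
    calc nf t ^ p * lf s ^ q ≤ (μ ^ p * nf s ^ p) * (μ ^ q * lf t ^ q) := by gcongr
      _ = (μ ^ p * μ ^ q) * (nf s ^ p * lf t ^ q) := by ring
      _ ≤ _ := by gcongr
  rw [← mul_div_assoc, div_le_div_iff₀ (by positivity) (by positivity)]
  calc _ = (C₁ * Real.log (1 / r) ^ 3 * (R * r ^ 2)) * (nf t ^ p * lf s ^ q) := by ring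
    _ ≤ (C₁ * Real.log (1 / r) ^ 3 * (R * r ^ 2)) * (μ ^ 8 * (nf s ^ p * lf t ^ q)) := by gcongr
    _ = _ := by ring

lemma controlWeight_le {μ r C₁ : ℝ} {nf lf : ℝ → ℝ} {s t : ℝ} (hμ : 1 ≤ μ)
    (hns : 1 ≤ nf s) (hnt : 1 ≤ nf t) (hls : 0 < lf s) (hlt : 0 < lf t)
    (hn : nf t ≤ μ * nf s) (hl : lf s ≤ μ * lf t) (hr : 0 < r) :
    controlWeight r C₁ nf lf t ≤ μ ^ 8 * controlWeight r C₁ nf lf s := by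
  have hns0 : 0 < nf s := by linarith
  have hnt0 : 0 < nf t := by linarith
  have hms : 0 < min (r ^ 2) (lf s) := lt_min (by positivity) hls
  have hmt : 0 < min (r ^ 2) (lf t) := lt_min (by positivity) hlt
  have hmin : min (r ^ 2) (lf s) ≤ μ * min (r ^ 2) (lf t) := by
    rw [mul_min_of_nonneg _ _ (by linarith)]
    exact min_le_min (le_mul_of_one_le_left (by positivity) hμ) hl
  unfold controlWeight
  rw [← mul_div_assoc, div_le_div_iff₀ hmt hms]
  calc C₁ ^ 2 * nf t ^ 6 * min (r ^ 2) (lf s)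
      ≤ C₁ ^ 2 * (μ * nf s) ^ 6 * (μ * min (r ^ 2) (lf t)) := by gcongr
    _ = μ ^ 7 * (C₁ ^ 2 * nf s ^ 6 * min (r ^ 2) (lf t)) := by ring
    _ ≤ μ ^ 8 * (C₁ ^ 2 * nf s ^ 6 * min (r ^ 2) (lf t)) := by
      gcongr
      norm_num
    _ = _ := by ring

/-- The infimum of the `δ > 0` at which the primitive of `f` from `t` reaches `c` is at most any
such `δ`. -/
lemma sInf_integral_ge_le {f : ℝ → ℝ} {t c δ : ℝ} (hδ : 0 < δ)
    (hc : c ≤ ∫ s in t..(t + δ), f s) :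
    sInf {δ : ℝ | 0 < δ ∧ c ≤ ∫ s in t..(t + δ), f s} ≤ δ :=
  csInf_le ⟨0, fun _ hx => hx.1.le⟩ ⟨hδ, hc⟩

/-- Up to the first time its primitive reaches `c ≥ 0`, the integral of `f` is at most `c`. -/
lemma integral_sInf_le {f : ℝ → ℝ} {t c b : ℝ} (hc : 0 ≤ c)
    (hb : sInf {δ : ℝ | 0 < δ ∧ c ≤ ∫ s in t..(t + δ), f s} ≤ b)
    (hf : IntervalIntegrable f volume t (t + b)) :
    ∫ s in t..(t + sInf {δ : ℝ | 0 < δ ∧ c ≤ ∫ s in t..(t + δ), f s}), f s ≤ c := by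
  set δ₀ := sInf {δ : ℝ | 0 < δ ∧ c ≤ ∫ s in t..(t + δ), f s} with hδ₀
  have hδ₀nn : 0 ≤ δ₀ := Real.sInf_nonneg fun _ hx => hx.1.le
  rcases hδ₀nn.eq_or_lt with h0 | h0
  · simpa [← h0] using hc
  have hcont : ContinuousOn (fun x => ∫ s in t..x, f s) (Set.Icc t (t + δ₀)) := by
    have := intervalIntegral.continuousOn_primitive_interval' hf Set.left_mem_uIcc
    refine this.mono ?_
    rw [Set.uIcc_of_le (by linarith)]
    exact Set.Icc_subset_Icc_right (by linarith)
  have hmem : t + δ₀ ∈ closure (Set.Ioo t (t + δ₀)) := by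
    rw [closure_Ioo (by linarith)]
    exact ⟨by linarith, le_rfl⟩
  refine ContinuousWithinAt.closure_le hmem
    ((hcont (t + δ₀) ⟨by linarith, le_rfl⟩).mono Set.Ioo_subset_Icc_self)
    continuousWithinAt_const fun x hx => ?_
  by_contra! hlt
  have := sInf_integral_ge_le (f := f) (t := t) (c := c) (δ := x - t) (by linarith [hx.1])
    (by rw [add_sub_cancel]; exact hlt.le)
  linarith [hx.2]

lemma intervalIntegrable_fh {d : ℕ} {h R r ρ C₁ K L a b : ℝ} {nf lf : ℝ → ℝ}
    {φ : ℝ → EuclideanSpace ℝ (Fin d)} (hh0 : 0 < h)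
    (hmn : Measurable nf) (hml : Measurable lf) (hφm : Measurable φ)
    (hφi : LocallyIntegrable (fun s => ‖φ s‖ ^ 2) volume)
    (hdrift0 : ∀ s, 0 ≤ driftWeight d R r ρ C₁ nf lf s)
    (hcontrol0 : ∀ s, 0 ≤ controlWeight r C₁ nf lf s)
    (hdrift : ∀ s ∈ Set.uIoc a b, driftWeight d R r ρ C₁ nf lf s ≤ K)
    (hcontrol : ∀ s ∈ Set.uIoc a b, controlWeight r C₁ nf lf s ≤ L) :
    IntervalIntegrable (fh h R r ρ C₁ nf lf φ) volume a b := by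
  have hdom : IntervalIntegrable (fun s => 2 / h + K + L * ‖φ s‖ ^ 2) volume a b :=
    intervalIntegrable_const.add
      ((hφi.integrableOn_isCompact isCompact_uIcc).intervalIntegrable.const_mul L)
  have hmeas : Measurable (fh h R r ρ C₁ nf lf φ) := by
    unfold fh
    fun_prop
  refine hdom.mono_fun' hmeas.aestronglyMeasurable ?_
  refine (ae_restrict_mem measurableSet_uIoc).mono fun s hs => ?_
  have hA := hdrift0 s
  have hB := hcontrol0 s
  dsimp only
  rw [fh_eq, Real.norm_of_nonneg (by positivity)]
  gcongr
  · exact hdrift s hs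
  · exact hcontrol s hs

/-- `δ(t) ≤ (h/2) ∧ (R r² λ_t^{1+dρ}/(C₁ (ln 1/r)³ n_t^{6+4dρ}))` and
`ε_φ(δ(t)) ≤ (r ∧ λ_t^{1/2})/(C₁ n_t³)`. -/
theorem stmt14 (d : ℕ) (hd : 1 ≤ d) (μ h R r ρ C₁ : ℝ) (nf lf : ℝ → ℝ)
    (φ : ℝ → EuclideanSpace ℝ (Fin d))
    (hμ : 1 ≤ μ) (hh0 : 0 < h) (hh1 : h ≤ 1)
    (hn1 : ∀ t, 1 ≤ nf t) (hl0 : ∀ t, 0 < lf t) (hl1 : ∀ t, lf t ≤ 1)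
    (hnL : ∀ s t, |t - s| ≤ h → nf t ≤ μ * nf s)
    (hlL : ∀ s t, |t - s| ≤ h → lf t ≤ μ * lf s)
    (hmn : Measurable nf) (hml : Measurable lf)
    (hφm : Measurable φ)
    (hφi : LocallyIntegrable (fun s => ‖φ s‖ ^ 2) volume)
    (hR : 0 < R) (hR1 : R < 1) (hr : 0 < r) (hr1 : r < 1)
    (hρ : 0 < ρ) (hρ1 : ρ < 1) (hdρ : (d : ℝ) * ρ ≤ 1 / 5) (hC : 1 ≤ C₁)
    (t : ℝ) :
    delfun h R r ρ C₁ μ nf lf φ t ≤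
        min (h / 2)
          (R * r ^ 2 * lf t ^ ((1 : ℝ) + d * ρ) /
            (C₁ * Real.log (1 / r) ^ 3 * nf t ^ ((6 : ℝ) + 4 * d * ρ))) ∧
      Real.sqrt (∫ s in t..(t + delfun h R r ρ C₁ μ nf lf φ t), ‖φ s‖ ^ 2) ≤
        min r (Real.sqrt (lf t)) / (C₁ * nf t ^ 3) := by
  have hμ8 : 0 < μ ^ 8 := by positivity
  have hc0 : 0 ≤ 1 / μ ^ 8 := by positivity
  have hc1 : 1 / μ ^ 8 ≤ 1 := (div_le_one hμ8).2 (one_le_pow₀ hμ)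
  have hA0 : ∀ s, 0 < driftWeight d R r ρ C₁ nf lf s := fun s =>
    driftWeight_pos (hn1 s) (hl0 s) hR hr hr1 hC
  have hB0 : ∀ s, 0 < controlWeight r C₁ nf lf s := fun s =>
    controlWeight_pos (hn1 s) (hl0 s) hr hC
  have hA : ∀ s u, |u - s| ≤ h →
      driftWeight d R r ρ C₁ nf lf u ≤ μ ^ 8 * driftWeight d R r ρ C₁ nf lf s := fun s u hsu =>
    driftWeight_le hμ (hn1 s) (hn1 u) (hl0 s) (hl0 u) (hnL s u hsu)
      (hlL u s (by rwa [abs_sub_comm])) hR hr hr1 hρ hdρ hC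
  have hB : ∀ s u, |u - s| ≤ h →
      controlWeight r C₁ nf lf u ≤ μ ^ 8 * controlWeight r C₁ nf lf s := fun s u hsu =>
    controlWeight_le hμ (hn1 s) (hn1 u) (hl0 s) (hl0 u) (hnL s u hsu)
      (hlL u s (by rwa [abs_sub_comm])) hr
  have hint : ∀ δ, 0 ≤ δ → δ ≤ h →
      IntervalIntegrable (fh h R r ρ C₁ nf lf φ) volume t (t + δ) := by
    intro δ hδ0 hδh
    have hclose : ∀ s ∈ Set.uIoc t (t + δ), |s - t| ≤ h := by
      intro s hs
      rw [Set.uIoc_of_le (by linarith)] at hs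
      rw [abs_le]
      constructor <;> linarith [hs.1, hs.2]
    exact intervalIntegrable_fh hh0 hmn hml hφm hφi (fun s => (hA0 s).le) (fun s => (hB0 s).le)
      (fun s hs => hA t s (hclose s hs)) (fun s hs => hB t s (hclose s hs))
  have hfh_half : delfun h R r ρ C₁ μ nf lf φ t ≤ h / 2 := by
    refine sInf_integral_ge_le (by positivity) (hc1.trans ?_)
    have hconst : ∫ _ in t..(t + h / 2), (2 / h : ℝ) = 1 := by
      rw [intervalIntegral.integral_const, smul_eq_mul]
      field_simp
      ring
    rw [← hconst]
    refine intervalIntegral.integral_mono_on (by linarith) intervalIntegrable_const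
      (hint _ (by positivity) (by linarith)) fun s _ => ?_
    have h1 := (hA0 s).le
    have h2 := (hB0 s).le
    rw [fh_eq]
    have : 0 ≤ controlWeight r C₁ nf lf s * ‖φ s‖ ^ 2 := by positivity
    linarith
  refine ⟨le_min hfh_half ?_, ?_⟩
  · have hinv : R * r ^ 2 * lf t ^ ((1 : ℝ) + d * ρ) /
        (C₁ * Real.log (1 / r) ^ 3 * nf t ^ ((6 : ℝ) + 4 * d * ρ)) =
        (driftWeight d R r ρ C₁ nf lf t)⁻¹ := by
      rw [driftWeight, inv_div]
    rw [hinv]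
    have hAt := hA0 t
    rcases le_total (h / 2) (driftWeight d R r ρ C₁ nf lf t)⁻¹ with hle | hle
    · exact hfh_half.trans hle
    refine sInf_integral_ge_le (inv_pos.2 hAt) ?_
    have hconst : ∫ _ in t..(t + (driftWeight d R r ρ C₁ nf lf t)⁻¹),
        (driftWeight d R r ρ C₁ nf lf t / μ ^ 8 : ℝ) = 1 / μ ^ 8 := by
      rw [intervalIntegral.integral_const, smul_eq_mul]
      field_simp
      ring
    rw [← hconst]
    have hinvpos := inv_pos.2 hAt
    refine intervalIntegral.integral_mono_on (by linarith) intervalIntegrable_const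
      (hint _ hinvpos.le (by linarith)) fun s hs => ?_
    have hs' : |t - s| ≤ h := by
      rw [abs_le]
      constructor <;> linarith [hs.1, hs.2]
    have h1 : driftWeight d R r ρ C₁ nf lf t / μ ^ 8 ≤ driftWeight d R r ρ C₁ nf lf s := by
      rw [div_le_iff₀' hμ8]
      exact hA s t hs'
    have h2 := (hB0 s).le
    have h3 : 0 ≤ controlWeight r C₁ nf lf s * ‖φ s‖ ^ 2 := by positivity
    have h4 : 0 < 2 / h := by positivity
    rw [fh_eq]
    linarith
  · have hδle := integral_sInf_le hc0 hfh_half (hint _ (by positivity) (by linarith))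
    have hδ0 : 0 ≤ delfun h R r ρ C₁ μ nf lf φ t := Real.sInf_nonneg fun _ hx => hx.1.le
    change ∫ s in t..(t + delfun h R r ρ C₁ μ nf lf φ t), fh h R r ρ C₁ nf lf φ s ≤ _ at hδle
    generalize delfun h R r ρ C₁ μ nf lf φ t = δ at *
    have hBt := hB0 t
    have hmul : controlWeight r C₁ nf lf t / μ ^ 8 * ∫ s in t..(t + δ), ‖φ s‖ ^ 2 ≤
        1 / μ ^ 8 := by
      rw [← intervalIntegral.integral_const_mul]
      refine le_trans (intervalIntegral.integral_mono_on (by linarith)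
        ((hφi.integrableOn_isCompact isCompact_uIcc).intervalIntegrable.const_mul _)
        (hint _ hδ0 (by linarith)) fun s hs => ?_) hδle
      have hs' : |t - s| ≤ h := by
        rw [abs_le]
        constructor <;> linarith [hs.1, hs.2]
      have h1 : controlWeight r C₁ nf lf t / μ ^ 8 * ‖φ s‖ ^ 2 ≤
          controlWeight r C₁ nf lf s * ‖φ s‖ ^ 2 := by
        gcongr
        rw [div_le_iff₀' hμ8]
        exact hB s t hs'
      have h2 := hA0 s
      have h3 : 0 < 2 / h := by positivity
      rw [fh_eq]
      linarith
    have hbound : ∫ s in t..(t + δ), ‖φ s‖ ^ 2 ≤ (controlWeight r C₁ nf lf t)⁻¹ := by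
      rw [div_mul_eq_mul_div, div_le_div_iff_of_pos_right hμ8] at hmul
      rwa [← one_div, le_div_iff₀' hBt]
    have hn0 : 0 < nf t := by linarith [hn1 t]
    have hsq : (controlWeight r C₁ nf lf t)⁻¹ =
        (min r (Real.sqrt (lf t)) / (C₁ * nf t ^ 3)) ^ 2 := by
      have hmin : min (r ^ 2) (lf t) = min r (Real.sqrt (lf t)) ^ 2 := by
        rw [← Real.sq_sqrt (hl0 t).le, Real.sqrt_sq (Real.sqrt_nonneg _)]
        exact ((pow_left_monotoneOn (n := 2)).map_min hr.le (Real.sqrt_nonneg (lf t))).symm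
      rw [controlWeight, inv_div, hmin]
      ring
    refine Real.sqrt_le_iff.2 ⟨by positivity, hbound.trans hsq.le⟩
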